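/- Let d ≥ 3, α = (d-2)/2, and let P be a homogeneous polynomial of degree l on ℝ^d. Then for every x ∈ ℝ^d, ∫_{S^{d-1}} e^{i(x|η)} P(η) dσ(η) = (i/2)^l Σ_{k=0}^{⌊l/2⌋} (-1)^k Γ(α+1)/(k! Γ(α+l+1-k)) · j_{α+l-k}(|x|) · (Δ^k P)(x), where Δ^k P denotes the k-fold Laplacian of P. -/

import Mathlib

open MeasureTheory MvPolynomial Finset
open scoped RealInnerProductSpace

noncomputable section

/-- The Euclidean Laplacian `Δ = Σ_{j=1}^d ∂²/∂x_j²` acting on polynomials on `ℝ^d`. -/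
def lap {d : ℕ} (P : MvPolynomial (Fin d) ℝ) : MvPolynomial (Fin d) ℝ :=
  ∑ i, pderiv i (pderiv i P)

/-- The rotation-invariant surface measure on `ℝ^d` (the `(d-1)`-dimensional Hausdorff
measure) normalized so that the unit sphere `S^{d-1}` has total mass `1`. -/
def sphereMeasure (d : ℕ) : Measure (EuclideanSpace ℝ (Fin d)) :=
  (μH[(d : ℝ) - 1] (Metric.sphere (0 : EuclideanSpace ℝ (Fin d)) 1))⁻¹ • μH[(d : ℝ) - 1]

/-- The spherical Bessel function
`j_ν(t) = Γ(ν+1)(t/2)^{-ν} J_ν(t) = Γ(ν+1) Σ_{k=0}^∞ (-1)^k/(Γ(k+1)Γ(k+ν+1)) (t/2)^{2k}`. -/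
def sphericalBesselJ (ν t : ℝ) : ℝ :=
  Real.Gamma (ν + 1) *
    ∑' k : ℕ, (-1) ^ k / (Real.Gamma (k + 1) * Real.Gamma (k + ν + 1)) * (t / 2) ^ (2 * k)

theorem finrank_orth {d : ℕ} (hd : 3 ≤ d) (v : EuclideanSpace ℝ (Fin d)) (hv : v ≠ 0) :
    ((Module.finrank ℝ (ℝ ∙ v)ᗮ : ℕ) : ℝ) = (d : ℝ) - 1 := by
  have h := Submodule.finrank_add_finrank_orthogonal (ℝ ∙ v)
  rw [finrank_span_singleton hv, finrank_euclideanSpace_fin] at h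
  have h' : (1 : ℝ) + (Module.finrank ℝ (ℝ ∙ v)ᗮ : ℕ) = d := by exact_mod_cast h
  linarith

theorem inner_orth {d : ℕ} (v : EuclideanSpace ℝ (Fin d)) (w : (ℝ ∙ v)ᗮ) :
    ⟪v, (w : EuclideanSpace ℝ (Fin d))⟫ = 0 :=
  Submodule.mem_orthogonal_singleton_iff_inner_right.1 w.2

theorem haus_sphere_lt_top {d : ℕ} (hd : 3 ≤ d) :
    μH[(d : ℝ) - 1] (Metric.sphere (0 : EuclideanSpace ℝ (Fin d)) 1) < ⊤ := by
  have hd0 : (0 : ℝ) ≤ (d : ℝ) - 1 := by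
    have : (3 : ℝ) ≤ d := by exact_mod_cast hd
    linarith
  apply (isCompact_sphere _ _).measure_lt_top_of_nhdsWithin
  intro v hv
  have hv1 : ‖v‖ = 1 := by simpa using hv
  have hv0 : v ≠ 0 := by rintro rfl; simp at hv1
  have hinner : ⟪v, v⟫ = 1 := by rw [real_inner_self_eq_norm_sq, hv1]; norm_num
  let f : (ℝ ∙ v)ᗮ → EuclideanSpace ℝ (Fin d) := fun w =>
    (‖(w : EuclideanSpace ℝ (Fin d)) + v‖)⁻¹ • ((w : EuclideanSpace ℝ (Fin d)) + v)
  have hne : ∀ w : (ℝ ∙ v)ᗮ, (w : EuclideanSpace ℝ (Fin d)) + v ≠ 0 := by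
    intro w h
    have h2 : ⟪v, (w : EuclideanSpace ℝ (Fin d)) + v⟫ = 1 := by
      rw [inner_add_right, inner_orth, hinner]; norm_num
    rw [h] at h2; simp at h2
  have hf : ContDiff ℝ 1 f := by
    have h1 : ContDiff ℝ 1 (fun w : (ℝ ∙ v)ᗮ => (w : EuclideanSpace ℝ (Fin d)) + v) :=
      ((ℝ ∙ v)ᗮ.subtypeL.contDiff).add contDiff_const
    exact ((h1.norm ℝ hne).inv fun w => by simpa using hne w).smul h1
  obtain ⟨K, hK⟩ := hf.contDiffOn.exists_lipschitzOnWith (s := Metric.closedBall 0 3) (by norm_num)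
    (convex_closedBall _ _) (isCompact_closedBall _ _)
  have him := hK.hausdorffMeasure_image_le hd0
  have hfin : μH[(d : ℝ) - 1] (Metric.closedBall (0 : (ℝ ∙ v)ᗮ) 3) < ⊤ := by
    rw [← finrank_orth hd v hv0]
    exact (isCompact_closedBall _ _).measure_lt_top
  refine ⟨f '' Metric.closedBall 0 3, ?_, him.trans_lt
    (ENNReal.mul_lt_top (ENNReal.rpow_lt_top_of_nonneg hd0 ENNReal.coe_ne_top) hfin)⟩
  have hopen : {η : EuclideanSpace ℝ (Fin d) | (1/2 : ℝ) < ⟪v, η⟫} ∈ nhds v := by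
    apply (isOpen_lt continuous_const (by fun_prop)).mem_nhds
    change (1/2 : ℝ) < ⟪v, v⟫
    rw [hinner]; norm_num
  filter_upwards [mem_nhdsWithin_of_mem_nhds hopen, self_mem_nhdsWithin] with η hη hηs
  have hη1 : ‖η‖ = 1 := by simpa using hηs
  change (1/2 : ℝ) < ⟪v, η⟫ at hη
  have hp : (0 : ℝ) < ⟪v, η⟫ := by linarith
  refine ⟨⟨(⟪v, η⟫)⁻¹ • η - v, ?_⟩, ?_, ?_⟩
  · rw [Submodule.mem_orthogonal_singleton_iff_inner_right, inner_sub_right, inner_smul_right,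
      hinner, inv_mul_cancel₀ hp.ne', sub_self]
  · rw [mem_closedBall_zero_iff, Submodule.coe_norm]
    refine (norm_sub_le _ _).trans ?_
    rw [norm_smul, hη1, hv1, norm_inv, Real.norm_of_nonneg hp.le, mul_one]
    have : (⟪v, η⟫)⁻¹ ≤ (1/2 : ℝ)⁻¹ := inv_anti₀ (by norm_num) hη.le
    norm_num at this ⊢
    linarith
  · simp only [f, sub_add_cancel]
    rw [norm_smul, hη1, norm_inv, Real.norm_of_nonneg hp.le, mul_one, inv_inv, smul_smul,
      mul_inv_cancel₀ hp.ne', one_smul]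

theorem haus_sphere_pos {d : ℕ} (hd : 3 ≤ d) :
    μH[(d : ℝ) - 1] (Metric.sphere (0 : EuclideanSpace ℝ (Fin d)) 1) ≠ 0 := by
  have hd0 : (0 : ℝ) ≤ (d : ℝ) - 1 := by
    have : (3 : ℝ) ≤ d := by exact_mod_cast hd
    linarith
  let v : EuclideanSpace ℝ (Fin d) := EuclideanSpace.single ⟨0, by omega⟩ 1
  have hv1 : ‖v‖ = 1 := by simp [v]
  have hv0 : v ≠ 0 := by intro h; rw [h] at hv1; simp at hv1
  intro h0
  have h1 := hausdorffMeasure_orthogonalProjectionOnto_le (𝕜 := ℝ) (ℝ ∙ v)ᗮ ((d : ℝ) - 1)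
    (Metric.sphere (0 : EuclideanSpace ℝ (Fin d)) 1) hd0
  rw [h0] at h1
  have h2 : Metric.closedBall (0 : (ℝ ∙ v)ᗮ) 1 ⊆
      (ℝ ∙ v)ᗮ.orthogonalProjectionOnto '' (Metric.sphere (0 : EuclideanSpace ℝ (Fin d)) 1) := by
    intro w hw
    rw [mem_closedBall_zero_iff] at hw
    have hw2 : 0 ≤ 1 - ‖w‖ ^ 2 := by nlinarith [norm_nonneg w]
    refine ⟨(w : EuclideanSpace ℝ (Fin d)) + Real.sqrt (1 - ‖w‖^2) • v, ?_, ?_⟩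
    · rw [mem_sphere_zero_iff_norm]
      have : ‖(w : EuclideanSpace ℝ (Fin d)) + Real.sqrt (1 - ‖w‖^2) • v‖ ^ 2 = 1 := by
        rw [norm_add_sq_real, inner_smul_right, real_inner_comm, inner_orth, norm_smul, hv1, mul_one,
          Real.norm_eq_abs, sq_abs, Real.sq_sqrt hw2, Submodule.coe_norm]
        ring
      nlinarith [norm_nonneg ((w : EuclideanSpace ℝ (Fin d)) + Real.sqrt (1 - ‖w‖^2) • v)]
    · rw [map_add, Submodule.orthogonalProjectionOnto_mem_subspace_eq_self, map_smul]
      rw [Submodule.orthogonalProjectionOnto_orthogonal_apply_eq_zero (Submodule.mem_span_singleton_self v)]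
      simp
  have h3 : μH[(d : ℝ) - 1] (Metric.closedBall (0 : (ℝ ∙ v)ᗮ) 1) = 0 :=
    le_antisymm ((measure_mono h2).trans h1) bot_le
  rw [← finrank_orth hd v hv0] at h3
  have h4 := Metric.measure_closedBall_pos (μH[(Module.finrank ℝ (ℝ ∙ v)ᗮ : ℕ)]) (0 : (ℝ ∙ v)ᗮ) one_pos
  exact absurd h3 (ne_of_gt h4)

/-- Normalized measure restricted to the sphere. -/
def sg (d : ℕ) : Measure (EuclideanSpace ℝ (Fin d)) :=
  (sphereMeasure d).restrict (Metric.sphere 0 1)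

theorem sg_prob {d : ℕ} (hd : 3 ≤ d) : IsProbabilityMeasure (sg d) := by
  constructor
  rw [sg, Measure.restrict_apply_univ, sphereMeasure, Measure.smul_apply, smul_eq_mul]
  exact ENNReal.inv_mul_cancel (haus_sphere_pos hd) (haus_sphere_lt_top hd).ne

theorem sg_norm (d : ℕ) : ∀ᵐ η ∂(sg d), ‖η‖ = 1 := by
  have := ae_restrict_mem (μ := sphereMeasure d)
    (Metric.isClosed_sphere (x := (0 : EuclideanSpace ℝ (Fin d))) (ε := 1)).measurableSet
  filter_upwards [this] with η hη
  simpa using hη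

theorem sg_mp {d : ℕ} (e : EuclideanSpace ℝ (Fin d) ≃ₗᵢ[ℝ] EuclideanSpace ℝ (Fin d)) :
    MeasurePreserving e (sg d) (sg d) := by
  have h := ((e.toIsometryEquiv.measurePreserving_hausdorffMeasure ((d : ℝ) - 1)).smul_measure
    (μH[(d : ℝ) - 1] (Metric.sphere (0 : EuclideanSpace ℝ (Fin d)) 1))⁻¹).restrict_preimage
    (Metric.isClosed_sphere (x := (0 : EuclideanSpace ℝ (Fin d))) (ε := 1)).measurableSet
  have hs : e.toIsometryEquiv ⁻¹' (Metric.sphere 0 1) = Metric.sphere 0 1 := by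
    ext; simp
  rw [hs] at h
  exact h

theorem sg_integrable {d : ℕ} (hd : 3 ≤ d) {F : Type*} [NormedAddCommGroup F] [NormedSpace ℝ F]
    [SecondCountableTopology F]
    (f : EuclideanSpace ℝ (Fin d) → F) (hf : Continuous f) : Integrable f (sg d) := by
  have := sg_prob hd
  obtain ⟨C, hC⟩ := (isCompact_sphere (0 : EuclideanSpace ℝ (Fin d)) 1).exists_bound_of_continuousOn
    hf.continuousOn
  refine Integrable.of_bound hf.aestronglyMeasurable C ?_
  filter_upwards [sg_norm d] with η hη
  exact hC η (by simpa using hη)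

/-- Moments of the sphere. -/
def mom {d : ℕ} (n : ℕ) (u : EuclideanSpace ℝ (Fin d)) : ℝ := ∫ η, ⟪u, η⟫ ^ n ∂(sg d)

theorem mom_eq {d : ℕ} (n : ℕ) {u v : EuclideanSpace ℝ (Fin d)} (h : ‖u‖ = ‖v‖) :
    mom n u = mom n v := by
  let e := (ℝ ∙ (u - v))ᗮ.reflection
  have he : e u = v := Submodule.reflection_sub h
  unfold mom
  rw [← (sg_mp e).integral_comp e.toHomeomorph.measurableEmbedding (fun η => ⟪v, η⟫ ^ n)]
  congr 1; ext η
  rw [← he, e.inner_map_map]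

theorem mom_smul {d : ℕ} (n : ℕ) (c : ℝ) (u : EuclideanSpace ℝ (Fin d)) :
    mom n (c • u) = c ^ n * mom n u := by
  unfold mom
  rw [← integral_const_mul]
  congr 1; ext η
  rw [real_inner_smul_left, mul_pow]

theorem mom_odd {d : ℕ} (n : ℕ) (hn : Odd n) (u : EuclideanSpace ℝ (Fin d)) : mom n u = 0 := by
  have h1 : mom n (-u) = mom n u := mom_eq n (norm_neg u)
  have h2 := mom_smul n (-1) u
  rw [hn.neg_one_pow, neg_one_smul] at h2
  linarith

theorem mom_norm {d : ℕ} (n : ℕ) {e : EuclideanSpace ℝ (Fin d)} (he : ‖e‖ = 1)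
    (u : EuclideanSpace ℝ (Fin d)) : mom n u = ‖u‖ ^ n * mom n e := by
  rw [← mom_smul]
  apply mom_eq
  rw [norm_smul, he]; simp

theorem coeff_two_aux (k : ℕ) : ((1 + Polynomial.X ^ 2 : Polynomial ℝ) ^ k).coeff 2 = k := by
  have : (1 + Polynomial.X ^ 2 : Polynomial ℝ) ^ k
      = Polynomial.expand ℝ 2 ((1 + Polynomial.X) ^ k) := by simp
  rw [this, Polynomial.coeff_expand (by norm_num)]
  simp [Polynomial.coeff_one_add_X_pow]

theorem mixed {d : ℕ} (hd : 3 ≤ d) (k : ℕ) {e f : EuclideanSpace ℝ (Fin d)} (he : ‖e‖ = 1)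
    (hf : ‖f‖ = 1) (hef : ⟪e, f⟫ = 0) :
    (2 * k + 1) * ∫ η, ⟪e, η⟫ ^ (2 * k) * ⟪f, η⟫ ^ 2 ∂(sg d) = mom (2 * k + 2) e := by
  have key : (∑ j ∈ Finset.range (2 * k + 2 + 1), Polynomial.C
      (((2 * k + 2).choose j : ℝ) * ∫ η, ⟪f, η⟫ ^ j * ⟪e, η⟫ ^ (2 * k + 2 - j) ∂(sg d)) *
        Polynomial.X ^ j : Polynomial ℝ) =
      Polynomial.C (mom (2 * k + 2) e) * (1 + Polynomial.X ^ 2) ^ (k + 1) := by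
    apply Polynomial.funext
    intro t
    have h1 : mom (2 * k + 2) (t • f + e) = (1 + t ^ 2) ^ (k + 1) * mom (2 * k + 2) e := by
      rw [mom_norm _ he]
      congr 1
      have : ‖t • f + e‖ ^ 2 = 1 + t ^ 2 := by
        rw [norm_add_sq_real, real_inner_smul_left, real_inner_comm, hef, norm_smul, hf, he]
        simp; ring
      rw [← this, ← pow_mul]; congr 1
    simp only [Polynomial.eval_finsetSum, Polynomial.eval_mul, Polynomial.eval_C,
      Polynomial.eval_pow, Polynomial.eval_X, Polynomial.eval_add, Polynomial.eval_one]
    rw [mul_comm (mom _ e), ← h1]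
    unfold mom
    have h2 : ∀ η : EuclideanSpace ℝ (Fin d), ⟪t • f + e, η⟫ ^ (2 * k + 2) =
        ∑ j ∈ Finset.range (2 * k + 2 + 1), (((2 * k + 2).choose j : ℝ) * t ^ j) *
          (⟪f, η⟫ ^ j * ⟪e, η⟫ ^ (2 * k + 2 - j)) := by
      intro η
      rw [inner_add_left, real_inner_smul_left, add_pow]
      refine Finset.sum_congr rfl fun j _ => ?_
      rw [mul_pow]; ring
    simp_rw [h2]
    rw [integral_finsetSum]
    · refine Finset.sum_congr rfl fun j _ => ?_
      rw [integral_const_mul]; ring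
    · intro j _
      exact sg_integrable hd _ (by fun_prop)
  have h2 := congrArg (fun p => Polynomial.coeff p 2) key
  simp only [Polynomial.coeff_C_mul, coeff_two_aux, Polynomial.finsetSum_coeff,
    Polynomial.coeff_X_pow] at h2
  rw [Finset.sum_eq_single 2 (by intro b _ hb; simp [hb.symm]) (by intro h; simp at h)] at h2
  simp only [if_true, mul_one] at h2
  have h3 : 2 * k + 2 - 2 = 2 * k := by omega
  rw [h3, Nat.cast_choose_two] at h2
  simp_rw [mul_comm (⟪f, _⟫ ^ 2)] at h2
  push_cast at h2
  have hk : (0 : ℝ) < k + 1 := by positivity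
  have h4 : ((k : ℝ) + 1) * ((2 * k + 1) * ∫ η, ⟪e, η⟫ ^ (2 * k) * ⟪f, η⟫ ^ 2 ∂(sg d))
     = (k + 1) * mom (2 * k + 2) e := by
    rw [mul_comm ((k : ℝ) + 1) (mom _ e), ← h2]; ring
  exact mul_left_cancel₀ hk.ne' h4

theorem mom_rec {d : ℕ} (hd : 3 ≤ d) (k : ℕ) {e : EuclideanSpace ℝ (Fin d)} (he : ‖e‖ = 1) :
    (2 * k + d) * mom (2 * k + 2) e = (2 * k + 1) * mom (2 * k) e := by
  let i0 : Fin d := ⟨0, by omega⟩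
  let b : Fin d → EuclideanSpace ℝ (Fin d) := fun i => EuclideanSpace.single i 1
  have hb : ∀ i, ‖b i‖ = 1 := by intro i; simp [b]
  have hbi : ∀ i η, ⟪b i, η⟫ = η i := by intro i η; simp [b, EuclideanSpace.inner_single_left]
  rw [mom_eq (2 * k + 2) (he.trans (hb i0).symm), mom_eq (2 * k) (he.trans (hb i0).symm)]
  have h1 : mom (2 * k) (b i0) = ∑ i, ∫ η, ⟪b i0, η⟫ ^ (2 * k) * ⟪b i, η⟫ ^ 2 ∂(sg d) := by
    rw [← integral_finsetSum]
    · apply integral_congr_ae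
      filter_upwards [sg_norm d] with η hη
      rw [← Finset.mul_sum]
      have : ∑ i, ⟪b i, η⟫ ^ 2 = 1 := by
        simp_rw [hbi]
        rw [← EuclideanSpace.real_norm_sq_eq, hη]; norm_num
      rw [this, mul_one]
    · intro j _
      exact sg_integrable hd _ (by fun_prop)
  rw [h1, Finset.mul_sum, ← Finset.add_sum_erase _ _ (Finset.mem_univ i0)]
  have h2 : ∀ i ∈ Finset.univ.erase i0, (2 * (k : ℝ) + 1) *
      ∫ η, ⟪b i0, η⟫ ^ (2 * k) * ⟪b i, η⟫ ^ 2 ∂(sg d) = mom (2 * k + 2) (b i0) := by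
    intro i hi
    apply mixed hd k (hb _) (hb _)
    rw [hbi]; simp [b, (Finset.ne_of_mem_erase hi).symm]
  rw [Finset.sum_congr rfl h2, Finset.sum_const, Finset.card_erase_of_mem (Finset.mem_univ _)]
  simp only [← pow_add, Finset.card_univ, Fintype.card_fin, nsmul_eq_mul]
  rw [Nat.cast_sub (by omega)]
  change _ = (2 * (k : ℝ) + 1) * mom (2 * k + 2) (b i0) + _
  push_cast
  ring

theorem mom_even {d : ℕ} (hd : 3 ≤ d) (α : ℝ) (hα : α = ((d : ℝ) - 2) / 2) (k : ℕ)
    {e : EuclideanSpace ℝ (Fin d)} (he : ‖e‖ = 1) :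
    mom (2 * k) e = Real.Gamma (α + 1) * (2 * k).factorial /
      (4 ^ k * k.factorial * Real.Gamma (k + α + 1)) := by
  have hd3 : (3 : ℝ) ≤ d := by exact_mod_cast hd
  have hα0 : 0 < α := by rw [hα]; linarith
  induction k with
  | zero =>
    have := sg_prob hd
    have : Real.Gamma (α + 1) ≠ 0 := (Real.Gamma_pos_of_pos (by linarith)).ne'
    simp [mom, this]
  | succ k ih =>
    have h := mom_rec hd k he
    rw [ih] at h
    have hg : Real.Gamma ((k + 1 : ℕ) + α + 1) = (k + α + 1) * Real.Gamma (k + α + 1) := by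
      rw [← Real.Gamma_add_one (by positivity)]; push_cast; ring_nf
    have hG : Real.Gamma (k + α + 1) ≠ 0 := (Real.Gamma_pos_of_pos (by positivity)).ne'
    have hd' : (d : ℝ) = 2 * α + 2 := by rw [hα]; ring
    rw [hg, show 2 * (k + 1) = 2 * k + 2 by ring, Nat.factorial_succ, Nat.factorial_succ,
      Nat.factorial_succ]
    have hne : (2 * (k : ℝ) + d) ≠ 0 := by positivity
    apply mul_left_cancel₀ hne
    rw [h, hd']
    push_cast
    have h3 : (k : ℝ) + α + 1 ≠ 0 := by positivity
    field_simp
    ring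

/-- Power series (in `s = |x|^2`) of the Bessel function without normalization. -/
def bes (ν s : ℝ) : ℝ :=
  ∑' k : ℕ, (-1) ^ k / ((k.factorial : ℝ) * Real.Gamma (k + ν + 1)) * (s / 4) ^ k

theorem bessel_eq (ν t : ℝ) : sphericalBesselJ ν t = Real.Gamma (ν + 1) * bes ν (t ^ 2) := by
  unfold sphericalBesselJ bes
  congr 1
  refine tsum_congr fun k => ?_
  rw [Real.Gamma_nat_eq_factorial, pow_mul, div_pow]
  norm_num

theorem fourier_base {d : ℕ} (hd : 3 ≤ d) (α : ℝ) (hα : α = ((d : ℝ) - 2) / 2)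
    (x : EuclideanSpace ℝ (Fin d)) :
    ∫ η, Complex.exp (Complex.I * ((⟪x, η⟫ : ℝ) : ℂ)) ∂(sg d) =
      ((Real.Gamma (α + 1) * bes α (‖x‖ ^ 2) : ℝ) : ℂ) := by
  have := sg_prob hd
  let F : ℕ → EuclideanSpace ℝ (Fin d) → ℂ := fun n η =>
    (Complex.I ^ n / n.factorial) * ((⟪x, η⟫ ^ n : ℝ) : ℂ)
  have hFi : ∀ n, Integrable (F n) (sg d) := fun n => sg_integrable hd _ (by fun_prop)
  have hFs : Summable fun n => ∫ η, ‖F n η‖ ∂(sg d) := by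
    refine Summable.of_nonneg_of_le (fun n => integral_nonneg fun _ => norm_nonneg _) ?_
      (Real.summable_pow_div_factorial ‖x‖)
    intro n
    have : ∫ η, ‖F n η‖ ∂(sg d) ≤ ∫ η, ‖x‖ ^ n / n.factorial ∂(sg d) := by
      apply integral_mono_ae (hFi n).norm (integrable_const _)
      filter_upwards [sg_norm d] with η hη
      simp only [F, norm_mul, norm_div, norm_pow, Complex.norm_I, one_pow, Complex.norm_natCast,
        Complex.norm_real]
      rw [div_mul_eq_mul_div, one_mul]
      gcongr
      have := norm_inner_le_norm (𝕜 := ℝ) x η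
      rwa [hη, mul_one] at this
    simpa using this
  have h := hasSum_integral_of_summable_integral_norm hFi hFs
  have hexp : ∀ η, ∑' n, F n η = Complex.exp (Complex.I * ((⟪x, η⟫ : ℝ) : ℂ)) := by
    intro η
    rw [Complex.exp_eq_exp_ℂ, NormedSpace.exp_eq_tsum_div]
    refine tsum_congr fun n => ?_
    simp only [F]
    rw [mul_pow]; push_cast; ring
  simp_rw [hexp] at h
  rw [← h.tsum_eq]
  let e : EuclideanSpace ℝ (Fin d) := EuclideanSpace.single ⟨0, by omega⟩ 1
  have he : ‖e‖ = 1 := by simp [e]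
  have hint : ∀ n, ∫ η, F n η ∂(sg d) = (Complex.I ^ n / n.factorial) * ((mom n x : ℝ) : ℂ) := by
    intro n
    simp only [F]
    rw [integral_const_mul, integral_complex_ofReal]; rfl
  have hinj : Function.Injective (fun k : ℕ => 2 * k) := fun a b h => by simpa using h
  rw [← hinj.tsum_eq (f := fun n => ∫ η, F n η ∂(sg d))]
  · unfold bes
    rw [← tsum_mul_left, Complex.ofReal_tsum]
    refine tsum_congr fun k => ?_
    rw [hint, mom_norm _ he, mom_even hd α hα k he, pow_mul, Complex.I_sq]
    have hf : ((2 * k).factorial : ℂ) ≠ 0 := by exact_mod_cast (2 * k).factorial_ne_zero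
    push_cast
    rw [div_pow, pow_mul]
    field_simp
  · intro n hn
    rw [Function.mem_support, hint] at hn
    by_contra hne
    apply hn
    have : Odd n := by
      rw [← Nat.not_even_iff_odd]
      rintro ⟨r, hr⟩
      exact hne ⟨r, by simp; omega⟩
    rw [mom_odd n this]; simp

theorem Gamma_lower (ν : ℝ) (hν : 0 ≤ ν) (k : ℕ) :
    Real.Gamma (ν + 1) ≤ Real.Gamma (k + ν + 1) := by
  induction k with
  | zero => simp
  | succ k ih =>
    refine ih.trans ?_
    have hp := Real.Gamma_pos_of_pos (s := k + ν + 1) (by positivity)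
    have : Real.Gamma ((k + 1 : ℕ) + ν + 1) = (k + ν + 1) * Real.Gamma (k + ν + 1) := by
      rw [← Real.Gamma_add_one (by positivity)]; push_cast; ring_nf
    rw [this]
    have hk : (0 : ℝ) ≤ k := by positivity
    nlinarith

theorem bes_coeff_bound (ν : ℝ) (hν : 0 ≤ ν) (k : ℕ) :
    ‖(-1 : ℝ) ^ k / ((k.factorial : ℝ) * Real.Gamma (k + ν + 1))‖ ≤
      (Real.Gamma (ν + 1))⁻¹ * (1 / k.factorial) := by
  have hp := Real.Gamma_pos_of_pos (s := ν + 1) (by positivity)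
  have hp' := Real.Gamma_pos_of_pos (s := k + ν + 1) (by positivity)
  have := Gamma_lower ν hν k
  rw [norm_div, norm_pow, norm_neg, norm_one, one_pow, Real.norm_of_nonneg (by positivity),
    one_div, mul_inv, mul_comm, one_div]
  gcongr

theorem bes_deriv (ν : ℝ) (hν : 0 ≤ ν) (s : ℝ) :
    HasDerivAt (bes ν) (-(1 / 4) * bes (ν + 1) s) s := by
  have hp := Real.Gamma_pos_of_pos (s := ν + 1) (by positivity)
  let a : ℕ → ℝ := fun k => (-1 : ℝ) ^ k / ((k.factorial : ℝ) * Real.Gamma (k + ν + 1))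
  let g : ℕ → ℝ → ℝ := fun k s => a k * (s / 4) ^ k
  let g' : ℕ → ℝ → ℝ := fun k s => a k * (k * (s / 4) ^ (k - 1) * (1 / 4))
  let R := |s| + 1
  have hR : 0 < R := by positivity
  let u : ℕ → ℝ := fun k => (Real.Gamma (ν + 1))⁻¹ * (1 / k.factorial) * (k * (R / 4) ^ (k - 1) * (1 / 4))
  have hu : Summable u := by
    rw [← summable_nat_add_iff 1]
    have := (Real.summable_pow_div_factorial (R / 4)).mul_left ((Real.Gamma (ν + 1))⁻¹ * (1 / 4))
    refine this.congr fun k => ?_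
    simp only [u, Nat.factorial_succ, Nat.add_sub_cancel]
    have : (k.factorial : ℝ) ≠ 0 := by positivity
    push_cast
    field_simp
  have hb : ∀ n y, y ∈ Metric.ball (0 : ℝ) R → ‖g' n y‖ ≤ u n := by
    intro n y hy
    have hy' : ‖y‖ ≤ R := by simpa using (mem_ball_zero_iff.1 hy).le
    simp only [g', u]
    rw [norm_mul]
    apply mul_le_mul (bes_coeff_bound ν hν n) _ (norm_nonneg _) (by positivity)
    rw [norm_mul, norm_mul, norm_pow, norm_div]
    norm_num
    gcongr
    simpa using hy'
  have hmem : s ∈ Metric.ball (0 : ℝ) R := by simp [R]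
  have h := hasDerivAt_tsum_of_isPreconnected (g := g) (g' := g') (y := s) (y₀ := 0) hu
    Metric.isOpen_ball (convex_ball (0 : ℝ) R).isPreconnected ?_ hb (by simpa using hR) ?_ hmem
  · have hs : ∑' n, g' n s = -(1 / 4) * bes (ν + 1) s := by
      have hsum : Summable fun n => g' n s := Summable.of_norm_bounded hu fun n => hb n s hmem
      rw [hsum.tsum_eq_zero_add]
      unfold bes
      rw [← tsum_mul_left]
      simp only [g', a, Nat.cast_zero, zero_mul, mul_zero, zero_add]
      refine tsum_congr fun k => ?_
      have hp' := Real.Gamma_pos_of_pos (s := k + (ν + 1) + 1) (by positivity)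
      have e1 : ((k + 1 : ℕ) : ℝ) + ν + 1 = k + (ν + 1) + 1 := by push_cast; ring
      have : (k.factorial : ℝ) ≠ 0 := by positivity
      rw [e1, Nat.factorial_succ, Nat.add_sub_cancel]
      push_cast
      field_simp
      ring
    rw [← hs]
    exact h
  · intro n y _
    have h1 : HasDerivAt (fun y : ℝ => y / 4) (1 / 4) y := (hasDerivAt_id y).div_const 4
    exact (h1.pow n).const_mul (a n)
  · apply summable_of_ne_finset_zero (s := {0})
    intro k hk
    simp at hk
    simp [g, hk]

theorem pderiv_comm' {d : ℕ} (i j : Fin d) (P : MvPolynomial (Fin d) ℝ) :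
    pderiv i (pderiv j P) = pderiv j (pderiv i P) := by
  induction P using MvPolynomial.induction_on with
  | C a => simp
  | add p q hp hq => simp [hp, hq]
  | mul_X p k hp =>
    simp only [Derivation.leibniz, map_add, smul_eq_mul, hp, pderiv_X, Pi.single_apply]
    split_ifs <;> simp <;> ring

/-- The Laplacian as a linear map. -/
def lapL (d : ℕ) : MvPolynomial (Fin d) ℝ →ₗ[ℝ] MvPolynomial (Fin d) ℝ :=
  ∑ i, (pderiv i : Derivation ℝ _ _).toLinearMap ∘ₗ (pderiv i : Derivation ℝ _ _).toLinearMap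

theorem lapL_apply {d : ℕ} (P : MvPolynomial (Fin d) ℝ) : lapL d P = lap P := by
  simp [lapL, lap, LinearMap.sum_apply]

theorem lap_iter {d : ℕ} (k : ℕ) (P : MvPolynomial (Fin d) ℝ) : lap^[k] P = (lapL d ^ k) P := by
  have : (lap : MvPolynomial (Fin d) ℝ → _) = lapL d := by
    funext P; exact (lapL_apply P).symm
  rw [this, Module.End.pow_apply]

theorem lapL_pderiv {d : ℕ} (i : Fin d) (P : MvPolynomial (Fin d) ℝ) :
    lapL d (pderiv i P) = pderiv i (lapL d P) := by
  rw [lapL_apply, lapL_apply, lap, lap, map_sum]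
  refine Finset.sum_congr rfl fun j _ => ?_
  rw [pderiv_comm' j i P, pderiv_comm' j i]

theorem lapL_X_mul {d : ℕ} (i : Fin d) (P : MvPolynomial (Fin d) ℝ) :
    lapL d (X i * P) = X i * lapL d P + 2 * pderiv i P := by
  rw [lapL_apply, lapL_apply, lap, lap, Finset.mul_sum]
  have : ∀ j, pderiv j (pderiv j (X i * P)) = X i * pderiv j (pderiv j P) +
      (if j = i then 2 * pderiv i P else 0) := by
    intro j
    simp only [Derivation.leibniz, map_add, smul_eq_mul, pderiv_X, Pi.single_apply]
    by_cases h : j = i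
    · subst h; simp; ring
    · simp [h, Ne.symm h]
  simp_rw [this]
  rw [Finset.sum_add_distrib]
  simp

theorem lapL_pow_X_mul {d : ℕ} (i : Fin d) (P : MvPolynomial (Fin d) ℝ) (k : ℕ) :
    (lapL d ^ (k + 1)) (X i * P) = X i * (lapL d ^ (k + 1)) P +
      C (2 * ((k : ℝ) + 1)) * pderiv i ((lapL d ^ k) P) := by
  induction k with
  | zero =>
    simp only [zero_add, pow_one, pow_zero, Module.End.one_apply, Nat.cast_zero, mul_one]
    rw [lapL_X_mul]; simp only [map_add, map_mul, map_ofNat, map_one, map_zero, zero_add, mul_one]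
  | succ k ih =>
    rw [pow_succ', Module.End.mul_apply, ih, map_add, lapL_X_mul, ← smul_eq_C_mul, map_smul,
      lapL_pderiv, ← Module.End.mul_apply, ← pow_succ', ← Module.End.mul_apply, ← pow_succ',
      smul_eq_C_mul]
    push_cast
    simp only [map_add, map_mul, map_ofNat, map_one]
    ring

theorem lapL_hom {d l : ℕ} {P : MvPolynomial (Fin d) ℝ} (hP : P.IsHomogeneous l) :
    (lapL d P).IsHomogeneous (l - 2) := by
  rw [lapL_apply, lap]
  apply IsHomogeneous.sum
  intro i _
  exact hP.pderiv.pderiv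

theorem lapL_zero {d : ℕ} (k : ℕ) : ∀ (l : ℕ) (P : MvPolynomial (Fin d) ℝ),
    P.IsHomogeneous l → l < 2 * k → (lapL d ^ k) P = 0 := by
  induction k with
  | zero => intro l P _ h; omega
  | succ k ih =>
    intro l P hP hl
    rw [pow_succ, Module.End.mul_apply]
    by_cases h : 2 ≤ l
    · exact ih _ _ (lapL_hom hP) (by omega)
    · have : lapL d P = 0 := by
        rw [lapL_apply, lap]
        apply Finset.sum_eq_zero
        intro i _
        have h0 : (pderiv i P).IsHomogeneous 0 := by
          have := hP.pderiv (i := i)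
          rwa [show l - 1 = 0 by omega] at this
        rw [totalDegree_eq_zero_iff_eq_C.1 (Nat.le_zero.1 h0.totalDegree_le)]
        simp
      rw [this, map_zero]

/-- unit vectors -/
def bv {d : ℕ} (i : Fin d) : EuclideanSpace ℝ (Fin d) := EuclideanSpace.single i 1

theorem eval_deriv {d : ℕ} (i : Fin d) (x : EuclideanSpace ℝ (Fin d))
    (P : MvPolynomial (Fin d) ℝ) :
    HasDerivAt (fun t : ℝ => eval (fun j => (x + t • bv i) j) P)
      (eval (fun j => x j) (pderiv i P)) 0 := by
  induction P using MvPolynomial.induction_on with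
  | C a => simpa using hasDerivAt_const (0 : ℝ) a
  | add p q hp hq =>
    simp only [eval_add, map_add]
    exact hp.fun_add hq
  | mul_X p k hp =>
    have h1 : HasDerivAt (fun t : ℝ => (x + t • bv i) k) ((bv i) k) 0 := by
      have := ((hasDerivAt_id (0 : ℝ)).mul_const ((bv i) k)).const_add (x k)
      simpa using this
    have h2 := hp.mul h1
    simp only [eval_mul, eval_X, Derivation.leibniz, smul_eq_mul, map_add]
    refine h2.congr_deriv ?_
    by_cases h : k = i
    · subst h; simp [bv]; ring
    · simp [bv, h, pderiv_X_of_ne h]; ring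

theorem bes_path_deriv {d : ℕ} (i : Fin d) (x : EuclideanSpace ℝ (Fin d)) (ν : ℝ) (hν : 0 ≤ ν) :
    HasDerivAt (fun t : ℝ => bes ν (‖x + t • bv i‖ ^ 2))
      (-(1 / 2) * x i * bes (ν + 1) (‖x‖ ^ 2)) 0 := by
  have hn : ∀ t : ℝ, ‖x + t • bv i‖ ^ 2 = ‖x‖ ^ 2 + t * (2 * x i) + t ^ 2 := by
    intro t
    rw [norm_add_sq_real, real_inner_smul_right, norm_smul]
    simp [bv, EuclideanSpace.inner_single_right]
    ring
  simp_rw [hn]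
  have h1 : HasDerivAt (fun t : ℝ => ‖x‖ ^ 2 + t * (2 * x i) + t ^ 2) (2 * x i) 0 := by
    have := (((hasDerivAt_id (0 : ℝ)).mul_const (2 * x i)).const_add (‖x‖ ^ 2)).fun_add
      ((hasDerivAt_id (0 : ℝ)).pow 2)
    exact this.congr_deriv (by simp)
  have h2 := (bes_deriv ν hν (‖x‖ ^ 2 + (0 : ℝ) * (2 * x i) + 0 ^ 2)).comp (0 : ℝ) h1
  refine h2.congr_deriv ?_
  simp; ring

/-- The integral. -/
def fI {d : ℕ} (P : MvPolynomial (Fin d) ℝ) (x : EuclideanSpace ℝ (Fin d)) : ℂ :=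
  ∫ η, Complex.exp (Complex.I * ((⟪x, η⟫ : ℝ) : ℂ)) * ((eval (fun i => η i) P : ℝ) : ℂ) ∂(sg d)

theorem cont_eval {d : ℕ} (P : MvPolynomial (Fin d) ℝ) :
    Continuous fun η : EuclideanSpace ℝ (Fin d) => eval (fun i => η i) P :=
  (MvPolynomial.continuous_eval P).comp (by fun_prop)

theorem cont_integrand {d : ℕ} (P : MvPolynomial (Fin d) ℝ) (x : EuclideanSpace ℝ (Fin d)) :
    Continuous fun η : EuclideanSpace ℝ (Fin d) =>
      Complex.exp (Complex.I * ((⟪x, η⟫ : ℝ) : ℂ)) * ((eval (fun i => η i) P : ℝ) : ℂ) := by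
  have := cont_eval P
  fun_prop

theorem fI_deriv {d : ℕ} (hd : 3 ≤ d) (P : MvPolynomial (Fin d) ℝ) (i : Fin d)
    (x : EuclideanSpace ℝ (Fin d)) :
    HasDerivAt (fun t : ℝ => fI P (x + t • bv i)) (Complex.I * fI (X i * P) x) 0 := by
  let F : ℝ → EuclideanSpace ℝ (Fin d) → ℂ := fun t η =>
    Complex.exp (Complex.I * ((⟪x + t • bv i, η⟫ : ℝ) : ℂ)) * ((eval (fun i => η i) P : ℝ) : ℂ)
  let F' : ℝ → EuclideanSpace ℝ (Fin d) → ℂ := fun t η =>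
    Complex.I * (Complex.exp (Complex.I * ((⟪x + t • bv i, η⟫ : ℝ) : ℂ)) *
      ((eval (fun i => η i) (X i * P) : ℝ) : ℂ))
  have h := hasDerivAt_integral_of_dominated_loc_of_deriv_le (μ := sg d) (F := F) (F' := F')
    (x₀ := (0 : ℝ)) (s := Set.univ) (bound := fun η => ‖eval (fun i => η i) (X i * P)‖)
    Filter.univ_mem (Filter.Eventually.of_forall fun t => (cont_integrand P _).aestronglyMeasurable)
    (sg_integrable hd _ (cont_integrand P _))
    ((continuous_const.mul (cont_integrand (X i * P) _)).aestronglyMeasurable)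
    ?_ (sg_integrable hd _ (cont_eval _).norm) ?_
  · have h2 := h.2
    have e : ∫ η, F' 0 η ∂(sg d) = Complex.I * fI (X i * P) x := by
      simp only [F', fI]
      rw [integral_const_mul]
      simp
    rw [e] at h2
    exact h2
  · refine Filter.Eventually.of_forall fun η t _ => ?_
    simp only [F', norm_mul, Complex.norm_I, one_mul, Complex.norm_real]
    rw [mul_comm Complex.I, Complex.norm_exp_ofReal_mul_I, one_mul]
  · refine Filter.Eventually.of_forall fun η t _ => ?_
    have h1 : HasDerivAt (fun t : ℝ => ⟪x + t • bv i, η⟫) (η i) t := by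
      have := ((hasDerivAt_id t).mul_const (η i)).const_add ⟪x, η⟫
      simp only [inner_add_left, real_inner_smul_left]
      have hb : ⟪bv i, η⟫ = η i := by simp [bv, EuclideanSpace.inner_single_left]
      rw [hb]
      simpa using this
    have h2 := ((h1.ofReal_comp.const_mul Complex.I).cexp).mul_const
      ((eval (fun i => η i) P : ℝ) : ℂ)
    refine h2.congr_deriv ?_
    simp only [F', eval_mul, eval_X]
    push_cast; ring

/-- The real sum on the right hand side. -/
def fG {d : ℕ} (α : ℝ) (l : ℕ) (P : MvPolynomial (Fin d) ℝ) (x : EuclideanSpace ℝ (Fin d)) : ℝ :=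
  ∑ k ∈ Finset.range (l + 1), (-1) ^ k / (k.factorial : ℝ) *
    (bes (α + l - k) (‖x‖ ^ 2) * eval (fun j => x j) ((lapL d ^ k) P))

theorem fG_deriv {d : ℕ} (α : ℝ) (hα : 0 ≤ α) (l : ℕ) (P : MvPolynomial (Fin d) ℝ)
    (hP : P.IsHomogeneous l) (i : Fin d) (x : EuclideanSpace ℝ (Fin d)) :
    HasDerivAt (fun t : ℝ => fG α l P (x + t • bv i)) (-(1 / 2) * fG α (l + 1) (X i * P) x) 0 := by
  have h1 : ∀ k ∈ Finset.range (l + 1), HasDerivAt (fun t : ℝ => (-1) ^ k / (k.factorial : ℝ) *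
      (bes (α + l - k) (‖x + t • bv i‖ ^ 2) *
        eval (fun j => (x + t • bv i) j) ((lapL d ^ k) P)))
      ((-1) ^ k / (k.factorial : ℝ) *
        (-(1 / 2) * x i * bes (α + l - k + 1) (‖x‖ ^ 2) * eval (fun j => x j) ((lapL d ^ k) P) +
         bes (α + l - k) (‖x‖ ^ 2) * eval (fun j => x j) (pderiv i ((lapL d ^ k) P)))) 0 := by
    intro k hk
    have hk' : (k : ℝ) ≤ l := by
      have := Finset.mem_range.1 hk
      exact_mod_cast (by omega : k ≤ l)
    have := ((bes_path_deriv i x (α + l - k) (by linarith)).mul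
      (eval_deriv i x ((lapL d ^ k) P))).const_mul ((-1) ^ k / (k.factorial : ℝ))
    simpa using this
  have h2 := HasDerivAt.fun_sum h1
  refine h2.congr_deriv ?_
  symm
  have hz : (lapL d ^ (l + 1)) P = 0 := lapL_zero _ l P hP (by omega)
  have e1 : fG α (l + 1) (X i * P) x =
      ∑ k ∈ Finset.range (l + 1 + 1), (-1) ^ k / (k.factorial : ℝ) *
        (bes (α + l - k + 1) (‖x‖ ^ 2) * (x i * eval (fun j => x j) ((lapL d ^ k) P))) +
      ∑ k ∈ Finset.range (l + 1), -2 * ((-1) ^ k / (k.factorial : ℝ) *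
        (bes (α + l - k) (‖x‖ ^ 2) * eval (fun j => x j) (pderiv i ((lapL d ^ k) P)))) := by
    unfold fG
    rw [Finset.sum_range_succ', Finset.sum_range_succ' _ (l + 1), add_right_comm,
      ← Finset.sum_add_distrib]
    congr 1
    · refine Finset.sum_congr rfl fun k _ => ?_
      have c1 : α + (l + 1 : ℕ) - (k + 1 : ℕ) = α + l - k := by push_cast; ring
      have c2 : α + l - (k + 1 : ℕ) + 1 = α + l - k := by push_cast; ring
      rw [c1, c2, lapL_pow_X_mul, Nat.factorial_succ]
      simp only [eval_add, eval_mul, eval_X, eval_C]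
      have : (k.factorial : ℝ) ≠ 0 := by positivity
      push_cast
      field_simp
      ring
    · have c1 : α + (l + 1 : ℕ) - (0 : ℕ) = α + l - (0 : ℕ) + 1 := by push_cast; ring
      rw [c1]; simp
  rw [e1, Finset.sum_range_succ _ (l + 1), hz]
  simp only [map_zero, mul_zero, add_zero]
  rw [← Finset.sum_add_distrib, Finset.mul_sum]
  refine Finset.sum_congr rfl fun k _ => ?_
  ring

theorem fI_add {d : ℕ} (hd : 3 ≤ d) (P Q : MvPolynomial (Fin d) ℝ) (x) :
    fI (P + Q) x = fI P x + fI Q x := by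
  unfold fI
  rw [← integral_add (sg_integrable hd _ (cont_integrand P x))
    (sg_integrable hd _ (cont_integrand Q x))]
  congr 1; ext η
  rw [eval_add]; push_cast; ring

theorem fI_smul {d : ℕ} (c : ℝ) (P : MvPolynomial (Fin d) ℝ) (x) :
    fI (c • P) x = c * fI P x := by
  unfold fI
  rw [← integral_const_mul]
  congr 1; ext η
  rw [smul_eval]; push_cast; ring

theorem fG_add {d : ℕ} (α : ℝ) (l : ℕ) (P Q : MvPolynomial (Fin d) ℝ) (x) :
    fG α l (P + Q) x = fG α l P x + fG α l Q x := by
  unfold fG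
  rw [← Finset.sum_add_distrib]
  refine Finset.sum_congr rfl fun k _ => ?_
  rw [map_add, eval_add]; ring

theorem fG_smul {d : ℕ} (α : ℝ) (l : ℕ) (c : ℝ) (P : MvPolynomial (Fin d) ℝ) (x) :
    fG α l (c • P) x = c * fG α l P x := by
  unfold fG
  rw [Finset.mul_sum]
  refine Finset.sum_congr rfl fun k _ => ?_
  rw [map_smul, smul_eval]; ring

theorem main_aux {d : ℕ} (hd : 3 ≤ d) (α : ℝ) (hα : α = ((d : ℝ) - 2) / 2) (l : ℕ) :
    ∀ P : MvPolynomial (Fin d) ℝ, P.IsHomogeneous l → ∀ x,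
      fI P x = (Complex.I / 2) ^ l * (Real.Gamma (α + 1) * (fG α l P x : ℝ)) := by
  have hd3 : (3 : ℝ) ≤ d := by exact_mod_cast hd
  have hα0 : 0 ≤ α := by rw [hα]; linarith
  induction l with
  | zero =>
    intro P hP x
    rw [totalDegree_eq_zero_iff_eq_C.1 (Nat.le_zero.1 hP.totalDegree_le)]
    have := fourier_base hd α hα x
    simp only [fI, fG, eval_C]
    rw [integral_mul_const, this]
    simp
    ring
  | succ l ih =>
    have step : ∀ (Q : MvPolynomial (Fin d) ℝ), Q.IsHomogeneous l → ∀ (i : Fin d) (x),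
        fI (X i * Q) x =
          (Complex.I / 2) ^ (l + 1) * (Real.Gamma (α + 1) * (fG α (l + 1) (X i * Q) x : ℝ)) := by
      intro Q hQ i x
      have h1 := fI_deriv hd Q i x
      have h2 := ((fG_deriv α hα0 l Q hQ i x).ofReal_comp.const_mul
        (Real.Gamma (α + 1) : ℂ)).const_mul ((Complex.I / 2) ^ l)
      have h3 : (fun t : ℝ => fI Q (x + t • bv i)) = fun t : ℝ => (Complex.I / 2) ^ l *
          ((Real.Gamma (α + 1) : ℂ) * (fG α l Q (x + t • bv i) : ℝ)) := by
        funext t; exact ih Q hQ _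
      rw [h3] at h1
      have h4 := h1.unique h2
      apply mul_left_cancel₀ Complex.I_ne_zero
      rw [h4, pow_succ]
      push_cast
      linear_combination (-(1 / 2) * (Complex.I / 2) ^ l * (Real.Gamma (α + 1) : ℂ) *
        (fG α (l + 1) (X i * Q) x : ℝ)) * Complex.I_sq
    intro P hP x
    have hsum : fI (∑ i, X i * pderiv i P) x = (Complex.I / 2) ^ (l + 1) *
        (Real.Gamma (α + 1) * (fG α (l + 1) (∑ i, X i * pderiv i P) x : ℝ)) := by
      apply Finset.sum_induction (fun i => X i * pderiv i P) (fun Q => fI Q x =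
        (Complex.I / 2) ^ (l + 1) * (Real.Gamma (α + 1) * (fG α (l + 1) Q x : ℝ)))
      · intro a b ha hb
        rw [fI_add hd, fG_add, ha, hb]; push_cast; ring
      · simp [fI, fG]
      · intro i _
        exact step _ (by simpa using hP.pderiv (i := i)) i x
    have heu : ∑ i, X i * pderiv i P = ((l : ℝ) + 1) • P := by
      rw [hP.sum_X_mul_pderiv]
      rw [← Nat.cast_smul_eq_nsmul ℝ]; push_cast; rfl
    rw [heu, fI_smul, fG_smul] at hsum
    have hl : (((l : ℝ) + 1 : ℝ) : ℂ) ≠ 0 := by exact_mod_cast (by positivity : (l : ℝ) + 1 ≠ 0)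
    apply mul_left_cancel₀ hl
    rw [hsum]; push_cast; ring

/-- **Fourier transform of the measure `P(η)dσ(η)` on the unit sphere, second form
(Theorem 3, equation (12)).** For a homogeneous polynomial `P` of degree `l` on `ℝ^d`
(`d ≥ 3`, `α = (d-2)/2`):
`∫_{S^{d-1}} e^{i(x|η)} P(η) dσ(η)
  = (i/2)^l Σ_{k=0}^{⌊l/2⌋} (-1)^k Γ(α+1)/(k! Γ(α+l+1-k)) j_{α+l-k}(|x|) (Δ^k P)(x)`. -/
theorem fourier_transform_sphere_second_form (d l : ℕ) (hd : 3 ≤ d)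
    (α : ℝ) (hα : α = ((d : ℝ) - 2) / 2)
    (P : MvPolynomial (Fin d) ℝ) (hP : P.IsHomogeneous l)
    (x : EuclideanSpace ℝ (Fin d)) :
    ∫ η in Metric.sphere (0 : EuclideanSpace ℝ (Fin d)) 1,
        Complex.exp (Complex.I * ((⟪x, η⟫ : ℝ) : ℂ)) * ((eval (fun i => η i) P : ℝ) : ℂ)
        ∂(sphereMeasure d) =
      (Complex.I / 2) ^ l *
        ∑ k ∈ Finset.range (l / 2 + 1),
          (((-1 : ℝ) ^ k * Real.Gamma (α + 1) /
                ((Nat.factorial k) * Real.Gamma (α + l + 1 - k)) *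
              sphericalBesselJ (α + l - k) ‖x‖ *
              eval (fun i => x i) (lap^[k] P) : ℝ) : ℂ) := by
  have hd3 : (3 : ℝ) ≤ d := by exact_mod_cast hd
  have hα0 : 0 ≤ α := by rw [hα]; linarith
  have h := main_aux hd α hα l P hP x
  change fI P x = _
  rw [h]
  congr 1
  rw [← Complex.ofReal_sum, ← Complex.ofReal_mul]
  congr 1
  unfold fG
  rw [Finset.mul_sum]
  symm
  have hsub : Finset.range (l / 2 + 1) ⊆ Finset.range (l + 1) := by
    intro k hk
    rw [Finset.mem_range] at hk ⊢
    omega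
  refine (Finset.sum_congr rfl ?_).trans (Finset.sum_subset hsub ?_)
  · intro k hk
    have hk' : (k : ℝ) ≤ l := by
      have := Finset.mem_range.1 hk
      exact_mod_cast (by omega : k ≤ l)
    rw [bessel_eq, lap_iter, show α + l + 1 - k = α + l - k + 1 by ring]
    have hG := (Real.Gamma_pos_of_pos (s := α + l - k + 1) (by linarith)).ne'
    have : (k.factorial : ℝ) ≠ 0 := by positivity
    field_simp
  · intro k _ hk
    rw [Finset.mem_range] at hk
    rw [lapL_zero k l P hP (by omega)]
    simp

end
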